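/- Let G be a group. Then G is not amenable (i.e., G admits no left-invariant mean) if and only if G contains a proper subset A ⊊ G that is symmetrically strongly completely syndetic. -/

import Mathlib

open Classical in
/-- `A ⊆ G` is strongly completely syndetic if for every `ε > 0` there is a finite set
`F ⊆ G` such that for every finite multiset `K` of elements of `G` there is `f ∈ F` with
`|f·K ∩ A| ≥ (1 - ε)·|K|`, counting with multiplicity. -/
def StronglyCompletelySyndetic {G : Type*} [Group G] (A : Set G) : Prop :=
  ∀ ε : ℝ, 0 < ε → ∃ F : Finset G, ∀ K : Multiset G, ∃ f ∈ F,
    (1 - ε) * (Multiset.card K : ℝ) ≤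
      (Multiset.card ((K.map (fun x => f * x)).filter (fun x => x ∈ A)) : ℝ)

/-- `A ⊆ G` is symmetrically strongly completely syndetic if it is strongly completely
syndetic and for all finite `F₁, F₂ ⊆ G` the set
`(⋂_{f ∈ F₁} f·A) ∩ (⋂_{f ∈ F₂} f·Aᶜ)` is either strongly completely syndetic or empty
(here `f·A = {x : f⁻¹ x ∈ A}`). -/
def SymmetricallyStronglyCompletelySyndetic {G : Type*} [Group G] (A : Set G) : Prop :=
  StronglyCompletelySyndetic A ∧ ∀ F₁ F₂ : Finset G,
    StronglyCompletelySyndetic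
      ((⋂ f ∈ F₁, {x : G | f⁻¹ * x ∈ A}) ∩ (⋂ f ∈ F₂, {x : G | f⁻¹ * x ∈ Aᶜ})) ∨
    ((⋂ f ∈ F₁, {x : G | f⁻¹ * x ∈ A}) ∩ (⋂ f ∈ F₂, {x : G | f⁻¹ * x ∈ Aᶜ})) = ∅

/-- A real-valued function on `S` is bounded if its absolute value admits a uniform bound. -/
def IsBddFun {S : Type*} (f : S → ℝ) : Prop :=
  ∃ C : ℝ, ∀ s, |f s| ≤ C

/-- `m` is a mean on `S`: a (real linear, positive, unital) functional on the space of
bounded real-valued functions on `S`; we encode it as a functional on all functions whose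
behaviour is constrained only on bounded functions. -/
def IsMean {S : Type*} (m : (S → ℝ) → ℝ) : Prop :=
  (∀ f g : S → ℝ, IsBddFun f → IsBddFun g → m (f + g) = m f + m g) ∧
  (∀ (c : ℝ) (f : S → ℝ), IsBddFun f → m (c • f) = c * m f) ∧
  (∀ f : S → ℝ, IsBddFun f → (∀ s, 0 ≤ f s) → 0 ≤ m f) ∧
  m (fun _ => 1) = 1

theorem IsBddFun.add {S : Type*} {f g : S → ℝ} (hf : IsBddFun f) (hg : IsBddFun g) :
    IsBddFun (f + g) := by
  obtain ⟨C, hC⟩ := hf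
  obtain ⟨D, hD⟩ := hg
  exact ⟨C + D, fun s => (abs_add_le _ _).trans (add_le_add (hC s) (hD s))⟩

theorem isBddFun_const {S : Type*} (c : ℝ) : IsBddFun (fun _ : S => c) :=
  ⟨|c|, fun _ => le_rfl⟩

theorem IsBddFun.smul {S : Type*} {f : S → ℝ} (hf : IsBddFun f) (c : ℝ) : IsBddFun (c • f) := by
  obtain ⟨C, hC⟩ := hf
  refine ⟨|c| * C, fun s => ?_⟩
  rw [Pi.smul_apply, smul_eq_mul, abs_mul]
  exact mul_le_mul_of_nonneg_left (hC s) (abs_nonneg c)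

theorem IsBddFun.sum {S ι : Type*} {f : ι → S → ℝ} (hf : ∀ i, IsBddFun (f i)) (s : Finset ι) :
    IsBddFun (∑ i ∈ s, f i) := by
  classical
  induction s using Finset.induction_on with
  | empty => exact isBddFun_const 0
  | insert i s hi ih => rw [Finset.sum_insert hi]; exact (hf i).add ih

theorem isBddFun_indicator {S : Type*} (A : Set S) : IsBddFun (A.indicator (1 : S → ℝ)) :=
  ⟨1, fun s => by by_cases h : s ∈ A <;> simp [h]⟩

theorem IsBddFun.comp {S T : Type*} {f : S → ℝ} (hf : IsBddFun f) (φ : T → S) :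
    IsBddFun (fun t => f (φ t)) :=
  hf.imp fun _ hC t => hC (φ t)

namespace IsMean

variable {S : Type*} {m : (S → ℝ) → ℝ}

theorem map_zero (hm : IsMean m) : m 0 = 0 := by
  have := hm.2.1 0 0 (isBddFun_const 0)
  simpa using this

theorem map_sum (hm : IsMean m) {ι : Type*} {f : ι → S → ℝ} (hf : ∀ i, IsBddFun (f i))
    (s : Finset ι) : m (∑ i ∈ s, f i) = ∑ i ∈ s, m (f i) := by
  classical
  induction s using Finset.induction_on with
  | empty => simpa using hm.map_zero
  | insert i s hi ih =>
    rw [Finset.sum_insert hi, Finset.sum_insert hi, hm.1 _ _ (hf i) (IsBddFun.sum hf s), ih]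

theorem indicator_nonneg (hm : IsMean m) (A : Set S) : 0 ≤ m (A.indicator 1) :=
  hm.2.2.1 _ (isBddFun_indicator A) fun s => Set.indicator_nonneg (fun _ _ => zero_le_one) s

theorem le_of_le (hm : IsMean m) {f : S → ℝ} (hf : IsBddFun f) {C : ℝ} (hC : ∀ s, f s ≤ C) :
    m f ≤ C := by
  have hneg : IsBddFun ((-1 : ℝ) • f) := hf.smul (-1)
  have h1 : m (fun _ => C) = C := by
    have := hm.2.1 C (fun _ => 1) (isBddFun_const 1)
    rw [hm.2.2.2, mul_one] at this
    convert this using 2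
    ext
    simp
  have h2 := hm.2.2.1 ((fun _ => C) + (-1 : ℝ) • f) ((isBddFun_const C).add hneg)
    fun s => by simpa using hC s
  rw [hm.1 _ _ (isBddFun_const C) hneg, h1, hm.2.1 _ _ hf] at h2
  linarith

theorem abs_le (hm : IsMean m) {f : S → ℝ} {C : ℝ} (hC : ∀ s, |f s| ≤ C) : |m f| ≤ C := by
  have hf : IsBddFun f := ⟨C, hC⟩
  have hneg : IsBddFun ((-1 : ℝ) • f) := hf.smul (-1)
  have h1 := hm.le_of_le hf fun s => (_root_.abs_le.1 (hC s)).2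
  have h2 := hm.le_of_le hneg (C := C) fun s => by
    have := (_root_.abs_le.1 (hC s)).1
    simp only [Pi.smul_apply, smul_eq_mul]
    linarith
  rw [hm.2.1 _ _ hf] at h2
  rw [_root_.abs_le]
  constructor <;> linarith

end IsMean

/-- A left-invariant mean gives full mass to every strongly completely syndetic set. -/
theorem StronglyCompletelySyndetic.one_le_mean {G : Type*} [Group G] {A : Set G}
    (hA : StronglyCompletelySyndetic A) {m : (G → ℝ) → ℝ} (hm : IsMean m)
    (hinv : ∀ (g : G) (f : G → ℝ), IsBddFun f → m (fun h => f (g * h)) = m f) :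
    1 ≤ m (A.indicator 1) := by
  classical
  refine le_of_forall_pos_le_add fun ε hε => ?_
  obtain ⟨F, hF⟩ := hA ε hε
  let τ : G → Finset G := fun x => F.filter fun f => f * x ∈ A
  let P : Finset G → G → ℝ := fun t => (τ ⁻¹' {t}).indicator 1
  have hP : ∀ t, IsBddFun (P t) := fun t => isBddFun_indicator _
  have hP0 : ∀ t, 0 ≤ m (P t) := fun t => hm.indicator_nonneg _
  let r : Finset G → G := fun t => if h : ∃ x, τ x = t then h.choose else 1
  have hr : ∀ t, m (P t) ≠ 0 → τ (r t) = t := by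
    intro t ht
    have hex : ∃ x, τ x = t := by
      by_contra hne
      apply ht
      have : P t = 0 := funext fun x =>
        Set.indicator_of_notMem (s := τ ⁻¹' {t}) (fun hx => hne ⟨x, hx⟩) _
      rw [this, hm.map_zero]
    simp only [r, hex, dif_pos]
    exact hex.choose_spec
  have hsum1 : ∑ t ∈ F.powerset, m (P t) = 1 := by
    rw [← hm.map_sum hP, ← hm.2.2.2]
    congr 1
    ext x
    rw [Finset.sum_apply, Finset.sum_eq_single (τ x)]
    · simp [P]
    · intro t _ ht
      exact Set.indicator_of_notMem (fun hx => ht hx.symm) _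
    · intro h
      exact absurd (Finset.mem_powerset.2 (Finset.filter_subset _ _)) h
  have hsumA : ∀ f ∈ F, ∑ t ∈ F.powerset with f ∈ t, m (P t) = m (A.indicator 1) := by
    intro f hf
    rw [← hm.map_sum hP, ← hinv f _ (isBddFun_indicator A)]
    congr 1
    ext x
    rw [Finset.sum_apply]
    by_cases hx : f * x ∈ A
    · rw [Finset.sum_eq_single (τ x)]
      · simp [P, hx]
      · intro t _ ht
        exact Set.indicator_of_notMem (fun hx => ht hx.symm) _
      · intro h
        refine absurd (Finset.mem_filter.2 ⟨Finset.mem_powerset.2 (Finset.filter_subset _ _), ?_⟩) h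
        simp [hf, hx]
    · rw [Finset.sum_eq_zero]
      · simp [hx]
      · intro t ht
        refine Set.indicator_of_notMem (fun hxt => hx ?_) _
        have h1 : τ x = t := hxt
        have h2 := (Finset.mem_filter.1 ht).2
        rw [← h1] at h2
        exact (Finset.mem_filter.1 h2).2
  have key : ∀ N : ℕ, (1 - ε) * (∑ t ∈ F.powerset, (⌊N * m (P t)⌋₊ : ℝ)) ≤
      N * m (A.indicator 1) := by
    intro N
    obtain ⟨f, hf, hle⟩ := hF (∑ t ∈ F.powerset, Multiset.replicate ⌊N * m (P t)⌋₊ (r t))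
    rw [← Multiset.countP_eq_card_filter, Multiset.countP_map,
      ← Multiset.countP_eq_card_filter] at hle
    rw [← Multiset.coe_countPAddMonoidHom, _root_.map_sum, Multiset.card_sum] at hle
    simp only [Multiset.coe_countPAddMonoidHom, Multiset.card_replicate] at hle
    push_cast at hle
    refine hle.trans ?_
    rw [← hsumA f hf, Finset.mul_sum, Finset.sum_filter]
    refine Finset.sum_le_sum fun t _ => ?_
    have hfloor := Nat.floor_le (mul_nonneg (Nat.cast_nonneg N) (hP0 t))
    by_cases h0 : m (P t) = 0
    · simp [h0]
    · have ht := hr t h0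
      have hiff : f * r t ∈ A ↔ f ∈ t := by
        conv_rhs => rw [← ht]
        simp [τ, hf]
      rw [Multiset.countP_eq_card_filter]
      by_cases hft : f ∈ t
      · rw [if_pos hft]
        refine le_trans ?_ hfloor
        exact Nat.cast_le.2 ((Multiset.card_le_card (Multiset.filter_le _ _)).trans_eq
          (Multiset.card_replicate _ _))
      · rw [if_neg hft, Multiset.filter_eq_nil.2]
        · simp
        · intro a ha
          rw [Multiset.eq_of_mem_replicate ha, hiff]
          exact hft
  by_contra! hlt
  have h0 := hm.indicator_nonneg A
  set a := m (A.indicator 1)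
  set c : ℝ := (F.powerset.card : ℝ)
  obtain ⟨N, hN⟩ := exists_nat_gt ((1 - ε) * c / (1 - ε - a))
  have hpos : 0 < 1 - ε - a := by linarith
  rw [div_lt_iff₀ hpos] at hN
  have hlow : (N : ℝ) - c ≤ ∑ t ∈ F.powerset, (⌊N * m (P t)⌋₊ : ℝ) := by
    have : ∑ t ∈ F.powerset, ((N : ℝ) * m (P t) - 1) = N - c := by
      rw [Finset.sum_sub_distrib, ← Finset.mul_sum, hsum1]
      simp [c]
    rw [← this]
    exact Finset.sum_le_sum fun t _ => by linarith [Nat.lt_floor_add_one ((N : ℝ) * m (P t))]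
  have := mul_le_mul_of_nonneg_left hlow (show (0 : ℝ) ≤ 1 - ε by linarith)
  have := key N
  nlinarith

theorem StronglyCompletelySyndetic.nonempty {G : Type*} [Group G] {A : Set G}
    (hA : StronglyCompletelySyndetic A) : A.Nonempty := by
  classical
  obtain ⟨F, hF⟩ := hA (1 / 2) (by norm_num)
  obtain ⟨f, -, hf⟩ := hF {1}
  by_contra hne
  rw [Set.not_nonempty_iff_eq_empty] at hne
  subst hne
  norm_num at hf

theorem SymmetricallyStronglyCompletelySyndetic.compl {G : Type*} [Group G] {A : Set G}
    (hA : SymmetricallyStronglyCompletelySyndetic A) (hne : A ≠ Set.univ) :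
    StronglyCompletelySyndetic Aᶜ := by
  have h := hA.2 ∅ {1}
  have heq : (⋂ f ∈ (∅ : Finset G), {x : G | f⁻¹ * x ∈ A}) ∩
      (⋂ f ∈ ({1} : Finset G), {x : G | f⁻¹ * x ∈ Aᶜ}) = Aᶜ := by
    ext x
    simp
  rw [heq] at h
  exact h.resolve_right fun h => hne (Set.compl_empty_iff.1 h)

theorem SymmetricallyStronglyCompletelySyndetic.not_exists_invariant_mean {G : Type*} [Group G]
    {A : Set G} (hA : SymmetricallyStronglyCompletelySyndetic A) (hne : A ≠ Set.univ) :
    ¬ ∃ m : (G → ℝ) → ℝ, IsMean m ∧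
        ∀ (g : G) (f : G → ℝ), IsBddFun f → m (fun h => f (g * h)) = m f := by
  rintro ⟨m, hm, hinv⟩
  have h1 := hA.1.one_le_mean hm hinv
  have h2 := (hA.compl hne).one_le_mean hm hinv
  have h3 := hm.1 _ _ (isBddFun_indicator A) (isBddFun_indicator Aᶜ)
  rw [Set.indicator_self_add_compl] at h3
  have h4 : m 1 = 1 := hm.2.2.2
  linarith

/-- The filter of sets containing a dense open set. -/
def denseOpenFilter (X : Type*) [TopologicalSpace X] : Filter X where
  sets := {s | Dense (interior s)}
  univ_sets := by simp
  sets_of_superset hs hst := hs.mono (interior_mono hst)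
  inter_sets hs ht := by
    simp only [Set.mem_ofPred_eq, interior_inter] at *
    exact hs.inter_of_isOpen_left ht isOpen_interior

theorem mem_denseOpenFilter {X : Type*} [TopologicalSpace X] {s : Set X} :
    s ∈ denseOpenFilter X ↔ Dense (interior s) :=
  Iff.rfl

instance denseOpenFilter_neBot (X : Type*) [TopologicalSpace X] [Nonempty X] :
    (denseOpenFilter X).NeBot := by
  rw [Filter.neBot_iff, ne_eq, ← Filter.empty_mem_iff_bot, mem_denseOpenFilter,
    interior_empty]
  exact fun h => Set.not_nonempty_empty h.nonempty

section Orbit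

variable {G X : Type*} [Group G] [TopologicalSpace X] [MulAction G X]

open Classical in
/-- A form of strong proximality together with minimality: every nonempty open set captures most of
any finite multiset of points, after translation by an element of a finite set depending only on
the open set and the required proportion. -/
def UniformlyCapturing (G X : Type*) [Group G] [TopologicalSpace X] [MulAction G X] : Prop :=
  ∀ V : Set X, IsOpen V → V.Nonempty → ∀ ε : ℝ, 0 < ε → ∃ F : Finset G, ∀ K : Multiset X,
    ∃ f ∈ F, (1 - ε) * (Multiset.card K : ℝ) ≤ (K.countP (fun x => f • x ∈ V) : ℝ)

theorem UniformlyCapturing.stronglyCompletelySyndetic (hX : UniformlyCapturing G X)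
    (l : Filter X) [l.NeBot] (hl : ∀ V : Set X, IsOpen V → ∀ g : G,
      (∀ᶠ x in l, g • x ∈ V) ∨ ∀ᶠ x in l, g • x ∉ V)
    {V : Set X} (hV : IsOpen V) (hne : V.Nonempty) :
    StronglyCompletelySyndetic {g : G | ∀ᶠ x in l, g • x ∈ V} := by
  classical
  intro ε hε
  obtain ⟨F, hF⟩ := hX V hV hne ε hε
  refine ⟨F, fun K => ?_⟩
  have hev : ∀ᶠ x in l, ∀ g ∈ (F ×ˢ K.toFinset).image (fun p => p.1 * p.2),
      (g • x ∈ V ↔ ∀ᶠ y in l, g • y ∈ V) := by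
    rw [Filter.eventually_all_finset]
    intro g _
    rcases hl V hV g with h | h
    · exact h.mono fun x hx => ⟨fun _ => h, fun _ => hx⟩
    · refine h.mono fun x hx => ⟨fun hx' => absurd hx' hx, fun h' => ?_⟩
      obtain ⟨y, hy, hy'⟩ := (h.and h').exists
      exact absurd hy' hy
  obtain ⟨x, hx⟩ := hev.exists
  obtain ⟨f, hf, hle⟩ := hF (K.map fun k => k • x)
  refine ⟨f, hf, ?_⟩
  rw [Multiset.card_map, Multiset.countP_map, ← Multiset.countP_eq_card_filter] at hle
  rw [← Multiset.countP_eq_card_filter, Multiset.countP_map, ← Multiset.countP_eq_card_filter]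
  refine hle.trans_eq ?_
  congr 1
  refine Multiset.countP_congr rfl fun k hk => ?_
  have := hx (f * k) (Finset.mem_image.2
    ⟨(f, k), Finset.mem_product.2 ⟨hf, Multiset.mem_toFinset.2 hk⟩, rfl⟩)
  rw [mul_smul] at this
  simpa using this

theorem UniformlyCapturing.exists_symmetricallyStronglyCompletelySyndetic
    [ContinuousConstSMul G X] [T2Space X] [Nontrivial X] (hX : UniformlyCapturing G X) :
    ∃ A : Set G, A ≠ Set.univ ∧ SymmetricallyStronglyCompletelySyndetic A := by
  classical
  let l : Ultrafilter X := Ultrafilter.of (denseOpenFilter X)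
  have hl : ∀ V : Set X, IsOpen V → ∀ g : G,
      (∀ᶠ x in (l : Filter X), g • x ∈ V) ∨ ∀ᶠ x in (l : Filter X), g • x ∉ V :=
    fun V _ g => Ultrafilter.eventually_or.1 (Filter.Eventually.of_forall fun x => em _)
  have hS : ∀ V : Set X, IsOpen V → V.Nonempty →
      StronglyCompletelySyndetic {g : G | ∀ᶠ x in (l : Filter X), g • x ∈ V} :=
    fun V hV hne => hX.stronglyCompletelySyndetic _ hl hV hne
  obtain ⟨a, b, hab⟩ := exists_pair_ne X
  obtain ⟨U, W, hU, hW, haU, hbW, hUW⟩ := t2_separation hab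
  have hcompl : ∀ g : G, ¬ (∀ᶠ x in (l : Filter X), g • x ∈ U) ↔
      ∀ᶠ x in (l : Filter X), g • x ∈ interior Uᶜ := by
    intro g
    rw [← Ultrafilter.eventually_not]
    have hd : ∀ᶠ x in (l : Filter X), g • x ∈ U ∪ interior Uᶜ := by
      refine Ultrafilter.of_le (denseOpenFilter X) ?_
      change Dense (interior ((fun x => g • x) ⁻¹' (U ∪ interior Uᶜ)))
      have hop : IsOpen (U ∪ interior Uᶜ) := hU.union isOpen_interior
      rw [(hop.preimage (continuous_const_smul g)).interior_eq]
      refine Dense.preimage ?_ (isOpenMap_smul g)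
      rw [dense_iff_closure_eq, Set.eq_univ_iff_forall, interior_compl]
      intro x
      by_cases hx : x ∈ closure U
      · exact closure_mono Set.subset_union_left hx
      · exact subset_closure (Or.inr hx)
    constructor
    · intro h
      filter_upwards [h, hd] with x hx hx'
      exact hx'.resolve_left hx
    · intro h
      filter_upwards [h] with x hx
      exact interior_subset hx
  refine ⟨{g : G | ∀ᶠ x in (l : Filter X), g • x ∈ U}, ?_, hS U hU ⟨a, haU⟩, fun F₁ F₂ => ?_⟩
  · intro huniv
    obtain ⟨g, hg⟩ := (hS W hW ⟨b, hbW⟩).nonempty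
    have hg' : g ∈ {g : G | ∀ᶠ x in (l : Filter X), g • x ∈ U} := huniv ▸ Set.mem_univ g
    obtain ⟨x, hx, hx'⟩ := (Filter.Eventually.and hg hg').exists
    exact Set.disjoint_left.1 hUW hx' hx
  · let V : Set X := (⋂ f ∈ F₁, {x | f⁻¹ • x ∈ U}) ∩ ⋂ f ∈ F₂, {x | f⁻¹ • x ∈ interior Uᶜ}
    have hV : IsOpen V :=
      (isOpen_biInter_finset fun f _ => hU.preimage (continuous_const_smul f⁻¹)).inter
        (isOpen_biInter_finset fun f _ => isOpen_interior.preimage (continuous_const_smul f⁻¹))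
    have heq : (⋂ f ∈ F₁, {x : G | f⁻¹ * x ∈ {g : G | ∀ᶠ x in (l : Filter X), g • x ∈ U}}) ∩
        (⋂ f ∈ F₂, {x : G | f⁻¹ * x ∈ {g : G | ∀ᶠ x in (l : Filter X), g • x ∈ U}ᶜ}) =
        {g : G | ∀ᶠ x in (l : Filter X), g • x ∈ V} := by
      ext g
      simp only [Set.mem_inter_iff, Set.mem_iInter, Set.mem_ofPred_eq, Set.mem_compl_iff, hcompl, V,
        Filter.eventually_and, Filter.eventually_all_finset]
      simp only [mul_smul]
    rw [heq]
    rcases V.eq_empty_or_nonempty with hV0 | hne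
    · right
      rw [hV0]
      ext g
      simp [l.neBot.ne]
    · exact Or.inl (hS V hV hne)

end Orbit

theorem multiset_map_sum_le_of_countP {α : Type*} (K : Multiset α) (p : α → Prop)
    [DecidablePred p] (φ : α → ℝ) {a b : ℝ} (ha : ∀ k ∈ K, ¬ p k → φ k ≤ a)
    (hb : ∀ k ∈ K, p k → φ k ≤ b) :
    (K.map φ).sum ≤ K.countP p * b + (K.card - K.countP p) * a := by
  induction K using Multiset.induction_on with
  | empty => simp
  | cons k K ih =>
    have ih := ih (fun x hx => ha x (Multiset.mem_cons_of_mem hx))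
      (fun x hx => hb x (Multiset.mem_cons_of_mem hx))
    by_cases hp : p k
    · have := hb k (Multiset.mem_cons_self k K) hp
      rw [Multiset.map_cons, Multiset.sum_cons, Multiset.countP_cons_of_pos _ hp,
        Multiset.card_cons]
      push_cast
      linarith
    · have := ha k (Multiset.mem_cons_self k K) hp
      rw [Multiset.map_cons, Multiset.sum_cons, Multiset.countP_cons_of_neg _ hp,
        Multiset.card_cons]
      push_cast
      linarith

theorem Convex.inv_card_smul_multiset_sum_mem {E : Type*} [AddCommGroup E] [Module ℝ E] {Q : Set E}
    (hQ : Convex ℝ Q) {K : Multiset E} (hK : ∀ k ∈ K, k ∈ Q) (h0 : K ≠ 0) : (K.card : ℝ)⁻¹ • K.sum ∈ Q := by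
  induction K using Multiset.induction_on with
  | empty => exact absurd rfl h0
  | cons k K ih =>
    rcases eq_or_ne K 0 with rfl | hne
    · simpa using hK
    have ih := ih (fun x hx => hK x (Multiset.mem_cons_of_mem hx)) hne
    have hpos : (0 : ℝ) < K.card := by exact_mod_cast Multiset.card_pos.2 hne
    have := hQ (hK k (Multiset.mem_cons_self k K)) ih (a := 1 / (K.card + 1))
      (b := K.card / (K.card + 1)) (by positivity) (by positivity) (by field_simp; ring)
    convert this using 1
    rw [Multiset.card_cons, Multiset.sum_cons, smul_add, smul_smul]
    push_cast
    congr 2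
    · simp
    · field_simp

section ConvexAction

open Topology

variable {E : Type*} [AddCommGroup E] [Module ℝ E] [TopologicalSpace E]

variable {G : Type*} [Group G] [DistribMulAction G E]

/-- Invariant nonempty closed convex sets. -/
structure IsConvexSubflow (G : Type*) [Group G] [DistribMulAction G E] (Q : Set E) : Prop where
  isClosed : IsClosed Q
  convex : Convex ℝ Q
  nonempty : Q.Nonempty
  smul_mem : ∀ (g : G), ∀ x ∈ Q, g • x ∈ Q

theorem IsConvexSubflow.exists_minimal {M : Set E} (hM : IsConvexSubflow G M) (hMc : IsCompact M) :
    ∃ Q ⊆ M, Minimal (IsConvexSubflow G) Q := by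
  obtain ⟨Q, hQM, hQ⟩ := zorn_superset_nonempty {Q | Q ⊆ M ∧ IsConvexSubflow G Q} (by
    intro c hc hchain hne
    have : Nonempty c := hne.to_subtype
    refine ⟨⋂₀ c, ⟨?_, ?_, ?_, ?_, ?_⟩, fun s hs => Set.sInter_subset_of_mem hs⟩
    · obtain ⟨s, hs⟩ := hne
      exact (Set.sInter_subset_of_mem hs).trans (hc hs).1
    · exact isClosed_sInter fun s hs => (hc hs).2.isClosed
    · exact convex_sInter fun s hs => (hc hs).2.convex
    · exact IsCompact.nonempty_sInter_of_directed_nonempty_isCompact_isClosed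
        (fun s hs t ht => (hchain.total hs ht).elim
          (fun h => ⟨s, hs, le_rfl, h⟩) fun h => ⟨t, ht, h, le_rfl⟩) (fun s hs => (hc hs).2.nonempty)
        (fun s hs => hMc.of_isClosed_subset (hc hs).2.isClosed (hc hs).1)
        (fun s hs => (hc hs).2.isClosed)
    · intro g x hx s hs
      exact (hc hs).2.smul_mem g x (hx s hs)) M ⟨le_rfl, hM⟩
  exact ⟨Q, hQM, hQ.prop.2, fun R hR hRQ => hQ.le_of_le ⟨hRQ.trans hQM, hR⟩ hRQ⟩

variable [SMulCommClass G ℝ E]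

theorem IsConvexSubflow.smul_mem_extremePoints {Q : Set E} (hQ : IsConvexSubflow G Q) (g : G)
    {x : E} (hx : x ∈ Q.extremePoints ℝ) : g • x ∈ Q.extremePoints ℝ := by
  refine ⟨hQ.smul_mem g x hx.1, fun y hy z hz h => ?_⟩
  rw [← hx.2 (hQ.smul_mem g⁻¹ y hy) (hQ.smul_mem g⁻¹ z hz), smul_inv_smul]
  obtain ⟨a, b, ha, hb, hab, h⟩ := h
  refine ⟨a, b, ha, hb, hab, ?_⟩
  rw [← smul_comm g⁻¹ a, ← smul_comm g⁻¹ b, ← smul_add, h, inv_smul_smul]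

/-- The extreme points of an invariant convex set, as an invariant subset. -/
def IsConvexSubflow.extremePoints {Q : Set E} (hQ : IsConvexSubflow G Q) : SubMulAction G E where
  carrier := Q.extremePoints ℝ
  smul_mem' g _ hx := hQ.smul_mem_extremePoints g hx

variable [ContinuousConstSMul G E]

theorem IsConvexSubflow.exists_finset_lt {Q : Set E} (hQ : Minimal (IsConvexSubflow G) Q)
    (hQc : IsCompact Q) (φ : StrongDual ℝ E) {u : ℝ} {x : E} (hx : x ∈ Q) (hu : u < φ x) :
    ∃ F : Finset G, ∀ q ∈ Q, ∃ f ∈ F, u < φ (f • q) := by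
  have hcont : ∀ g : G, Continuous fun y : E => φ (g • y) :=
    fun g => φ.continuous.comp (continuous_const_smul g)
  obtain ⟨F, hF⟩ := hQc.elim_finite_subcover (fun g : G => {y | u < φ (g • y)})
    (fun g => isOpen_lt continuous_const (hcont g)) (by
      intro q hq
      by_contra hne
      simp only [Set.mem_iUnion, Set.mem_ofPred_eq, not_exists, not_lt] at hne
      have hR : IsConvexSubflow G (Q ∩ ⋂ g : G, {y | φ (g • y) ≤ u}) := by
        refine ⟨hQ.prop.isClosed.inter
          (isClosed_iInter fun g => isClosed_le (hcont g) continuous_const),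
          hQ.prop.convex.inter (convex_iInter fun g => ?_), ⟨q, hq, Set.mem_iInter.2 hne⟩, ?_⟩
        · intro y hy z hz a b ha hb hab
          simp only [Set.mem_ofPred_eq] at hy hz ⊢
          rw [smul_add, smul_comm g a, smul_comm g b, map_add, map_smul φ a, map_smul φ b]
          simp only [smul_eq_mul]
          calc a * φ (g • y) + b * φ (g • z) ≤ a * u + b * u := by gcongr
            _ = u := by rw [← add_mul, hab, one_mul]
        · rintro g y ⟨hy, hy'⟩
          refine ⟨hQ.prop.smul_mem g y hy, Set.mem_iInter.2 fun h => ?_⟩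
          have := Set.mem_iInter.1 hy' (h * g)
          simpa only [Set.mem_ofPred_eq, mul_smul] using this
      have h1 := Set.mem_iInter.1 (hQ.le_of_le hR Set.inter_subset_left hx).2 1
      simp only [Set.mem_ofPred_eq, one_smul] at h1
      exact hu.not_ge h1)
  refine ⟨F, fun q hq => ?_⟩
  simpa using hF hq

variable [IsTopologicalAddGroup E] [ContinuousSMul ℝ E]

theorem IsCompact.convexJoin {s t : Set E} (hs : IsCompact s) (ht : IsCompact t) :
    IsCompact (convexJoin ℝ s t) := by
  have h : _root_.convexJoin ℝ s t =
      (fun p : ℝ × E × E => (1 - p.1) • p.2.1 + p.1 • p.2.2) '' (Set.Icc (0 : ℝ) 1 ×ˢ s ×ˢ t) := by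
    ext x
    simp only [mem_convexJoin, segment_eq_image, Set.mem_image, Set.mem_prod, Prod.exists]
    constructor
    · rintro ⟨a, ha, b, hb, θ, hθ, rfl⟩
      exact ⟨θ, a, b, ⟨hθ, ha, hb⟩, rfl⟩
    · rintro ⟨θ, a, b, ⟨hθ, ha, hb⟩, rfl⟩
      exact ⟨a, ha, b, hb, θ, hθ, rfl⟩
  rw [h]
  exact (isCompact_Icc.prod (hs.prod ht)).image (by fun_prop)

/-- The complement of a neighbourhood of an extreme point `x` of a compact convex set is contained
in a compact convex subset missing `x`. -/
theorem exists_compact_convex_superset_of_mem_extremePoints [LocallyConvexSpace ℝ E] [T2Space E]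
    {Q : Set E} (hQ : IsCompact Q) (hQc : Convex ℝ Q) {x : E} (hx : x ∈ Q.extremePoints ℝ)
    {V : Set E} (hV : IsOpen V) (hxV : x ∈ V) :
    ∃ C : Set E, IsCompact C ∧ Convex ℝ C ∧ C ⊆ Q ∧ x ∉ C ∧ Q \ V ⊆ C := by
  refine (hQ.diff hV).induction_on
    (p := fun s => ∃ C : Set E, IsCompact C ∧ Convex ℝ C ∧ C ⊆ Q ∧ x ∉ C ∧ s ⊆ C) ?_ ?_ ?_ ?_
  · exact ⟨∅, isCompact_empty, convex_empty, Set.empty_subset _, Set.notMem_empty _, le_rfl⟩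
  · rintro s t hst ⟨C, h1, h2, h3, h4, h5⟩
    exact ⟨C, h1, h2, h3, h4, hst.trans h5⟩
  · rintro s t ⟨C, hC1, hC2, hC3, hC4, hC5⟩ ⟨D, hD1, hD2, hD3, hD4, hD5⟩
    rcases C.eq_empty_or_nonempty with rfl | hC
    · exact ⟨D, hD1, hD2, hD3, hD4, Set.union_subset (hC5.trans (Set.empty_subset _)) hD5⟩
    rcases D.eq_empty_or_nonempty with rfl | hD
    · exact ⟨C, hC1, hC2, hC3, hC4, Set.union_subset hC5 (hD5.trans (Set.empty_subset _))⟩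
    refine ⟨convexJoin ℝ C D, hC1.convexJoin hD1, hC2.convexJoin hD2,
      convexJoin_subset hC3 hD3 hQc, ?_, Set.union_subset
        (hC5.trans (subset_convexJoin_left hD)) (hD5.trans (subset_convexJoin_right hC))⟩
    rw [mem_convexJoin]
    rintro ⟨a, ha, b, hb, hab⟩
    rcases (mem_extremePoints_iff_forall_segment.1 hx).2 a (hC3 ha) b (hD3 hb) hab with rfl | rfl
    · exact hC4 ha
    · exact hD4 hb
  · rintro y ⟨hyQ, hyV⟩
    have hxy : y ≠ x := fun h => hyV (h ▸ hxV)
    obtain ⟨φ, hφ⟩ := geometric_hahn_banach_point_point hxy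
    obtain ⟨c, hc1, hc2⟩ := exists_between hφ
    have hle : IsClosed {z | φ z ≤ c} := isClosed_le φ.continuous continuous_const
    refine ⟨Q \ V ∩ {z | φ z ≤ c}, ?_, Q ∩ {z | φ z ≤ c}, hQ.inter_right hle,
      hQc.inter (convex_halfSpace_le φ.toLinearMap.isLinear c), Set.inter_subset_left,
      fun h => hc2.not_ge h.2, Set.inter_subset_inter_left _ Set.sdiff_subset⟩
    refine Filter.inter_mem self_mem_nhdsWithin (mem_nhdsWithin_of_mem_nhds ?_)
    filter_upwards [(isOpen_lt φ.continuous continuous_const).mem_nhds hc1] with z hz using hz.le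

open Pointwise in
theorem IsConvexSubflow.uniformlyCapturing_extremePoints [LocallyConvexSpace ℝ E] [T2Space E]
    {Q : Set E} (hQ : Minimal (IsConvexSubflow G) Q) (hQc : IsCompact Q) :
    UniformlyCapturing G hQ.prop.extremePoints := by
  classical
  rintro V hV ⟨⟨x, hx⟩, hxV⟩ ε hε
  have hx : x ∈ Q.extremePoints ℝ := hx
  obtain ⟨V, hV', rfl⟩ := isOpen_induced_iff.1 hV
  rcases le_or_gt 1 ε with h1 | h1
  · refine ⟨{1}, fun K => ⟨1, Finset.mem_singleton_self 1, ?_⟩⟩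
    exact (mul_nonpos_of_nonpos_of_nonneg (by linarith) (Nat.cast_nonneg _)).trans
      (Nat.cast_nonneg _)
  obtain ⟨C, hC, hCc, hCQ, hxC, hVC⟩ :=
    exists_compact_convex_superset_of_mem_extremePoints hQc hQ.prop.convex hx hV' hxV
  rcases C.eq_empty_or_nonempty with rfl | hCne
  · refine ⟨{1}, fun K => ⟨1, Finset.mem_singleton_self 1, ?_⟩⟩
    rw [Multiset.countP_eq_card.2]
    · nlinarith [Nat.cast_nonneg (α := ℝ) K.card]
    · intro k _
      by_contra hk
      rw [one_smul] at hk
      exact hVC ⟨extremePoints_subset k.2, hk⟩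
  have hxD : x ∉ ε • C + (1 - ε) • Q := by
    rintro ⟨_, ⟨c, hc, rfl⟩, _, ⟨q, hq, rfl⟩, h⟩
    exact hxC (hx.2 (hCQ hc) hq ⟨ε, 1 - ε, hε, by linarith, by ring, h⟩ ▸ hc)
  obtain ⟨φ, u, hφD, hφx⟩ := geometric_hahn_banach_closed_point
    ((hCc.smul ε).add (hQ.prop.convex.smul (1 - ε)))
    ((hC.smul ε).add (hQc.smul (1 - ε))).isClosed hxD
  obtain ⟨c, hc, hcmax⟩ := hC.exists_isMaxOn hCne φ.continuous.continuousOn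
  obtain ⟨q, hq, hqmax⟩ := hQc.exists_isMaxOn hQ.prop.nonempty φ.continuous.continuousOn
  have hcq : φ c ≤ φ q := hqmax (hCQ hc)
  have hu : ε * φ c + (1 - ε) * φ q < u := by
    simpa using hφD _ (Set.add_mem_add (Set.smul_mem_smul_set hc) (Set.smul_mem_smul_set hq))
  obtain ⟨F, hF⟩ := exists_finset_lt hQ hQc φ hx.1 hφx
  refine ⟨F, fun K => ?_⟩
  rcases eq_or_ne K 0 with rfl | hK
  · obtain ⟨f, hf, -⟩ := hF x hx.1
    exact ⟨f, hf, by simp⟩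
  have hKpos : (0 : ℝ) < K.card := by exact_mod_cast Multiset.card_pos.2 hK
  have hmean := hQ.prop.convex.inv_card_smul_multiset_sum_mem (K := K.map (↑))
    (by
      intro k hk
      obtain ⟨k, -, rfl⟩ := Multiset.mem_map.1 hk
      exact extremePoints_subset k.2) (by simpa using hK)
  rw [Multiset.card_map] at hmean
  obtain ⟨f, hf, hlt⟩ := hF _ hmean
  refine ⟨f, hf, ?_⟩
  have hsum := multiset_map_sum_le_of_countP K (fun k => f • k ∈ ((↑) : _ → E) ⁻¹' V)
    (fun k => φ (f • (k : E))) (a := φ c) (b := φ q)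
    (fun k _ hk => hcmax (hVC ⟨hQ.prop.smul_mem f _ (extremePoints_subset k.2), hk⟩))
    (fun k _ _ => hqmax (hQ.prop.smul_mem f _ (extremePoints_subset k.2)))
  have heq : φ (f • ((K.card : ℝ)⁻¹ • (K.map ((↑) : _ → E)).sum)) =
      (K.card : ℝ)⁻¹ * (K.map fun k : hQ.prop.extremePoints => φ (f • (k : E))).sum := by
    rw [smul_comm, map_smul, smul_eq_mul, Multiset.smul_sum, map_multiset_sum, Multiset.map_map,
      Multiset.map_map]
    rfl
  rw [heq, ← div_eq_inv_mul, lt_div_iff₀ hKpos] at hlt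
  set n : ℝ := (Multiset.card K : ℝ)
  set r : ℝ := (K.countP (fun k => f • k ∈ ((↑) : _ → E) ⁻¹' V) : ℝ)
  by_contra! hr
  nlinarith [mul_nonneg (sub_nonneg.2 hr.le) (sub_nonneg.2 hcq), mul_lt_mul_of_pos_right hu hKpos]

theorem IsConvexSubflow.exists_uniformlyCapturing [LocallyConvexSpace ℝ E] [T2Space E]
    {M : Set E} (hM : IsConvexSubflow G M) (hMc : IsCompact M)
    (hfix : ¬ ∃ x ∈ M, ∀ g : G, g • x = x) :
    ∃ S : SubMulAction G E, Nontrivial S ∧ UniformlyCapturing G S := by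
  obtain ⟨Q, hQM, hQ⟩ := hM.exists_minimal hMc
  have hQc : IsCompact Q := hMc.of_isClosed_subset hQ.prop.isClosed hQM
  refine ⟨hQ.prop.extremePoints, ?_, uniformlyCapturing_extremePoints hQ hQc⟩
  obtain ⟨x, hx⟩ := hQc.extremePoints_nonempty hQ.prop.nonempty
  by_contra hnt
  rw [not_nontrivial_iff_subsingleton] at hnt
  exact hfix ⟨x, hQM hx.1, fun g => congrArg Subtype.val
    (hnt.elim ⟨g • x, hQ.prop.smul_mem_extremePoints g hx⟩ ⟨x, hx⟩)⟩

end ConvexAction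

section Mean

/-- Means that vanish on unbounded functions. -/
def meanSet (S : Type*) : Set ((S → ℝ) → ℝ) :=
  {m | IsMean m ∧ ∀ f, ¬ IsBddFun f → m f = 0}

theorem isClosed_meanSet (S : Type*) : IsClosed (meanSet S) := by
  have h : meanSet S =
      (((⋂ (f : S → ℝ) (g : S → ℝ) (_ : IsBddFun f) (_ : IsBddFun g),
        {m : (S → ℝ) → ℝ | m (f + g) = m f + m g}) ∩
      ((⋂ (c : ℝ) (f : S → ℝ) (_ : IsBddFun f), {m : (S → ℝ) → ℝ | m (c • f) = c * m f}) ∩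
      ((⋂ (f : S → ℝ) (_ : IsBddFun f) (_ : ∀ s, 0 ≤ f s), {m : (S → ℝ) → ℝ | 0 ≤ m f}) ∩
        {m : (S → ℝ) → ℝ | m (fun _ => 1) = 1}))) ∩
      ⋂ (f : S → ℝ) (_ : ¬ IsBddFun f), {m : (S → ℝ) → ℝ | m f = 0}) := by
    ext m
    simp only [meanSet, IsMean, Set.mem_ofPred_eq, Set.mem_inter_iff, Set.mem_iInter]
  rw [h]
  refine IsClosed.inter (IsClosed.inter ?_ (IsClosed.inter ?_ (IsClosed.inter ?_ ?_))) ?_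
  · exact isClosed_iInter fun f => isClosed_iInter fun g => isClosed_iInter fun _ =>
      isClosed_iInter fun _ => isClosed_eq (by fun_prop) (by fun_prop)
  · exact isClosed_iInter fun c => isClosed_iInter fun f => isClosed_iInter fun _ =>
      isClosed_eq (by fun_prop) (by fun_prop)
  · exact isClosed_iInter fun f => isClosed_iInter fun _ => isClosed_iInter fun _ =>
      isClosed_le (by fun_prop) (by fun_prop)
  · exact isClosed_eq (by fun_prop) (by fun_prop)
  · exact isClosed_iInter fun f => isClosed_iInter fun _ => isClosed_eq (by fun_prop) (by fun_prop)

theorem isCompact_meanSet (S : Type*) : IsCompact (meanSet S) := by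
  classical
  let C : (S → ℝ) → ℝ := fun f => if h : IsBddFun f then h.choose else 0
  refine (isCompact_univ_pi fun f => isCompact_Icc (a := -C f) (b := C f)).of_isClosed_subset
    (isClosed_meanSet S) ?_
  rintro m ⟨hm, h0⟩ f -
  by_cases hf : IsBddFun f
  · simp only [C, hf, dif_pos]
    exact abs_le.1 (hm.abs_le hf.choose_spec)
  · simp [C, hf, h0 f hf]

theorem convex_meanSet (S : Type*) : Convex ℝ (meanSet S) := by
  rintro m ⟨⟨h1, h2, h3, h4⟩, h5⟩ n ⟨⟨k1, k2, k3, k4⟩, k5⟩ a b ha hb hab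
  refine ⟨⟨fun f g hf hg => ?_, fun c f hf => ?_, fun f hf hpos => ?_, ?_⟩, fun f hf => ?_⟩
  · simp only [Pi.add_apply, Pi.smul_apply, smul_eq_mul, h1 f g hf hg, k1 f g hf hg]
    ring
  · simp only [Pi.add_apply, Pi.smul_apply, smul_eq_mul, h2 c f hf, k2 c f hf]
    ring
  · have := h3 f hf hpos
    have := k3 f hf hpos
    simp only [Pi.add_apply, Pi.smul_apply, smul_eq_mul]
    positivity
  · simp [h4, k4, hab]
  · simp [h5 f hf, k5 f hf]

open Classical in
theorem nonempty_meanSet (S : Type*) [Nonempty S] : (meanSet S).Nonempty := by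
  obtain ⟨s⟩ := ‹Nonempty S›
  refine ⟨fun f => if IsBddFun f then f s else 0,
    ⟨fun f g hf hg => ?_, fun c f hf => ?_, fun f hf hpos => ?_, ?_⟩, fun f hf => if_neg hf⟩
  · simp [hf, hg, hf.add hg]
  · simp [hf, hf.smul c]
  · simp [hf, hpos s]
  · simp [isBddFun_const]

variable {G : Type*} [Group G]

/-- The action of a group on functionals on real functions induced by left translation. -/
abbrev translationAction (G : Type*) [Group G] : DistribMulAction G ((G → ℝ) → ℝ) where
  smul g m := fun f => m fun h => f (g * h)
  one_smul m := by
    ext f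
    change m (fun h => f (1 * h)) = m f
    simp only [one_mul]
  mul_smul a b m := by
    ext f
    change m (fun h => f (a * b * h)) = m (fun h => f (a * (b * h)))
    simp only [mul_assoc]
  smul_zero _ := rfl
  smul_add _ _ _ := rfl

theorem isBddFun_translate_iff {g : G} {f : G → ℝ} :
    IsBddFun (fun h => f (g * h)) ↔ IsBddFun f :=
  ⟨fun hf => by simpa using hf.comp fun h => g⁻¹ * h, fun hf => hf.comp _⟩

theorem translate_mem_meanSet (g : G) {m : (G → ℝ) → ℝ} (hm : m ∈ meanSet G) :
    (fun f => m fun h => f (g * h)) ∈ meanSet G := by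
  obtain ⟨⟨h1, h2, h3, h4⟩, h5⟩ := hm
  exact ⟨⟨fun f k hf hk => h1 _ _ (hf.comp _) (hk.comp _), fun c f hf => h2 c _ (hf.comp _),
    fun f hf hpos => h3 _ (hf.comp _) fun s => hpos _, h4⟩,
    fun f hf => h5 _ (isBddFun_translate_iff.not.2 hf)⟩

theorem exists_symmetricallyStronglyCompletelySyndetic_of_not_exists_invariant_mean
    (hG : ¬ ∃ m : (G → ℝ) → ℝ, IsMean m ∧
        ∀ (g : G) (f : G → ℝ), IsBddFun f → m (fun h => f (g * h)) = m f) :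
    ∃ A : Set G, A ≠ Set.univ ∧ SymmetricallyStronglyCompletelySyndetic A := by
  let _ := translationAction G
  have : SMulCommClass G ℝ ((G → ℝ) → ℝ) := ⟨fun _ _ _ => rfl⟩
  have : ContinuousConstSMul G ((G → ℝ) → ℝ) :=
    ⟨fun g => continuous_pi fun f => continuous_apply fun h => f (g * h)⟩
  have hM : IsConvexSubflow G (meanSet G) :=
    ⟨isClosed_meanSet G, convex_meanSet G, nonempty_meanSet G,
      fun g _ hm => translate_mem_meanSet g hm⟩
  obtain ⟨S, hS, hcap⟩ := hM.exists_uniformlyCapturing (isCompact_meanSet G) (by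
    rintro ⟨m, hm, hfix⟩
    exact hG ⟨m, hm.1, fun g f _ => congrFun (hfix g) f⟩)
  have : ContinuousConstSMul G S :=
    ⟨fun g => ((continuous_const_smul g).comp continuous_subtype_val).subtype_mk _⟩
  exact hcap.exists_symmetricallyStronglyCompletelySyndetic

end Mean

/-- A group `G` is non-amenable (admits no left-invariant mean) iff `G` contains a proper
symmetrically strongly completely syndetic subset. -/
theorem not_amenable_iff_symmetricallyStronglyCompletelySyndetic {G : Type*} [Group G] :
    (¬ ∃ m : (G → ℝ) → ℝ, IsMean m ∧
        ∀ (g : G) (f : G → ℝ), IsBddFun f → m (fun h => f (g * h)) = m f) ↔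
      ∃ A : Set G, A ≠ Set.univ ∧ SymmetricallyStronglyCompletelySyndetic A := by
  constructor
  · exact exists_symmetricallyStronglyCompletelySyndetic_of_not_exists_invariant_mean
  · rintro ⟨A, hne, hA⟩
    exact hA.not_exists_invariant_mean hne
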